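/- Let G be a connected cograph and v a vertex of G. Then M_{G,v} ≥ M_G, with equality if and only if G is isomorphic to K_1 (i.e., G has exactly one vertex). -/

import Mathlib

open SimpleGraph Finset

/-- The collection of nonempty vertex subsets inducing a connected subgraph. -/
noncomputable def connSets {V : Type*} [Fintype V] (G : SimpleGraph V) : Finset (Finset V) :=
  (Set.toFinite {S : Finset V | S.Nonempty ∧ (G.induce (S : Set V)).Connected}).toFinset

/-- The global mean `M_G`: the average cardinality of the nonempty vertex subsets
inducing a connected subgraph. -/
noncomputable def globalMean {V : Type*} [Fintype V] (G : SimpleGraph V) : ℝ :=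
  (∑ S ∈ connSets G, (S.card : ℝ)) / ((connSets G).card : ℝ)

/-- The collection of vertex subsets containing `v` and inducing a connected subgraph. -/
noncomputable def localSets {V : Type*} [Fintype V] (G : SimpleGraph V) (v : V) :
    Finset (Finset V) :=
  (Set.toFinite {S : Finset V | v ∈ S ∧ (G.induce (S : Set V)).Connected}).toFinset

/-- The local mean `M_{G,v}`: the average cardinality of the vertex subsets containing `v`
and inducing a connected subgraph. -/
noncomputable def localMean {V : Type*} [Fintype V] (G : SimpleGraph V) (v : V) : ℝ :=
  (∑ S ∈ localSets G v, (S.card : ℝ)) / ((localSets G v).card : ℝ)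

/-- The collection of vertex subsets of size at least `2` inducing a connected subgraph. -/
noncomputable def mstarSets {V : Type*} [Fintype V] (G : SimpleGraph V) : Finset (Finset V) :=
  (Set.toFinite {S : Finset V | 2 ≤ S.card ∧ (G.induce (S : Set V)).Connected}).toFinset

/-- The `M*` mean `M*_G`: the average cardinality of the vertex subsets of size at least `2`
inducing a connected subgraph (it equals `0` if there are no such subsets, by the
`0/0 = 0` convention of real division). -/
noncomputable def mstarMean {V : Type*} [Fintype V] (G : SimpleGraph V) : ℝ :=
  (∑ S ∈ mstarSets G, (S.card : ℝ)) / ((mstarSets G).card : ℝ)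

/-- A cograph is a graph with no induced subgraph isomorphic to the path on 4 vertices. -/
def IsCograph {V : Type*} (G : SimpleGraph V) : Prop :=
  IsEmpty (SimpleGraph.pathGraph 4 ↪g G)

/-- The `n`-skillet `S_n = K_1 + (K_1 ∪ K_{n-2})`: vertex `0` is adjacent to all other
vertices, vertex `1` is adjacent only to vertex `0`, and the vertices `2, …, n-1` form a
clique, each also adjacent to vertex `0`. -/
def skillet (n : ℕ) : SimpleGraph (Fin n) :=
  SimpleGraph.fromRel (fun i j => (i : ℕ) = 0 ∨ (2 ≤ (i : ℕ) ∧ 2 ≤ (j : ℕ)))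


def P4Free {V : Type*} (G : SimpleGraph V) : Prop :=
  ∀ x y v z : V, G.Adj x y → G.Adj y v → G.Adj v z → ¬ G.Adj x v → ¬ G.Adj x z → ¬ G.Adj y z → False

lemma p4free_of_cograph {V : Type*} (G : SimpleGraph V) (h : IsCograph G) : P4Free G := by
  intro x y v z h1 h2 h3 h4 h5 h6
  have n1 : x ≠ v := by rintro rfl; exact h5 h3
  have n2 : x ≠ z := by rintro rfl; exact h4 h3.symm
  have n3 : y ≠ z := by rintro rfl; exact h5 h1
  have m1 := h1.ne
  have m2 := h2.ne
  have m3 := h3.ne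
  refine h.false ⟨⟨![x, y, v, z], ?_⟩, ?_⟩
  · intro i j hij
    fin_cases i <;> fin_cases j <;> simp_all
  · intro i j
    change G.Adj (![x, y, v, z] i) (![x, y, v, z] j) ↔ _
    have h4' : ¬ G.Adj v x := fun h => h4 (G.adj_symm h)
    have h5' : ¬ G.Adj z x := fun h => h5 (G.adj_symm h)
    have h6' : ¬ G.Adj z y := fun h => h6 (G.adj_symm h)
    fin_cases i <;> fin_cases j <;>
      simp [pathGraph_adj, h1, h2, h3, h4, h5, h6, h1.symm, h2.symm, h3.symm, h4', h5', h6']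

lemma p4free_compl {V : Type*} (G : SimpleGraph V) (h : P4Free G) : P4Free Gᶜ := by
  intro x y v z h1 h2 h3 h4 h5 h6
  have n1 : x ≠ v := by rintro rfl; exact h5 h3
  have n2 : x ≠ z := by rintro rfl; exact h4 h3.symm
  have n3 : y ≠ z := by rintro rfl; exact h5 h1
  rw [compl_adj] at *
  have a4 : G.Adj x v := by tauto
  have a5 : G.Adj x z := by tauto
  have a6 : G.Adj y z := by tauto
  exact h v x z y a4.symm a5 a6.symm (fun h => h3.2 h) (fun h => h2.2 h.symm) (fun h => h1.2 h)

/-- no edges between the parts -/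
def SepP {V : Type*} [DecidableEq V] (G : SimpleGraph V) (U A B : Finset V) : Prop :=
  A.Nonempty ∧ B.Nonempty ∧ Disjoint A B ∧ A ∪ B = U ∧ ∀ a ∈ A, ∀ b ∈ B, ¬ G.Adj a b

def JoiP {V : Type*} [DecidableEq V] (G : SimpleGraph V) (U A B : Finset V) : Prop :=
  A.Nonempty ∧ B.Nonempty ∧ Disjoint A B ∧ A ∪ B = U ∧ ∀ a ∈ A, ∀ b ∈ B, G.Adj a b

lemma sep_compl {V : Type*} [DecidableEq V] (G : SimpleGraph V) (U A B : Finset V) :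
    SepP Gᶜ U A B ↔ JoiP G U A B := by
  unfold SepP JoiP
  constructor
  · rintro ⟨h1, h2, h3, h4, h5⟩
    refine ⟨h1, h2, h3, h4, fun a ha b hb => ?_⟩
    have := h5 a ha b hb
    rw [compl_adj] at this
    have : a ≠ b := by rintro rfl; exact Finset.disjoint_left.1 h3 ha hb
    tauto
  · rintro ⟨h1, h2, h3, h4, h5⟩
    refine ⟨h1, h2, h3, h4, fun a ha b hb => ?_⟩
    have := h5 a ha b hb
    rw [compl_adj]
    tauto

lemma joi_compl {V : Type*} [DecidableEq V] (G : SimpleGraph V) (U A B : Finset V) :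
    JoiP Gᶜ U A B ↔ SepP G U A B := by
  rw [← sep_compl, compl_compl]

lemma split_step {V : Type*} [DecidableEq V] (G : SimpleGraph V) (hG : P4Free G)
    (W : Finset V) (v : V) (hv : v ∉ W) (A B : Finset V) (hs : SepP G W A B) :
    ∃ A B, SepP G (insert v W) A B ∨ JoiP G (insert v W) A B := by
  classical
  obtain ⟨hA, hB, hd, hU, he⟩ := hs
  by_cases hM : ∀ w ∈ W, G.Adj v w
  · refine ⟨{v}, W, Or.inr ⟨by simp, ?_, by simpa using hv, by rw [Finset.insert_eq], by simpa using hM⟩⟩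
    rw [← hU]; exact hA.mono Finset.subset_union_left
  push Not at hM
  obtain ⟨x0, hx0, hx0v⟩ := hM
  let R : V → V → Prop := fun a b => G.Adj a b ∧ b ∈ W
  let C : Finset V := W.filter (fun w => Relation.ReflTransGen R x0 w)
  have hCW : C ⊆ W := Finset.filter_subset _ _
  have hx0C : x0 ∈ C := Finset.mem_filter.2 ⟨hx0, .refl⟩
  have hCcl : ∀ a ∈ C, ∀ b ∈ W, G.Adj a b → b ∈ C := by
    intro a ha b hb hab
    exact Finset.mem_filter.2 ⟨hb, (Finset.mem_filter.1 ha).2.tail ⟨hab, hb⟩⟩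
  have hD : (W \ C).Nonempty := by
    have key : ∀ (A B : Finset V), A ∪ B = W → (∀ a ∈ A, ∀ b ∈ B, ¬ G.Adj a b) → x0 ∈ A → ∀ c, Relation.ReflTransGen R x0 c → c ∈ A := by
      intro A B hU he hx c hc
      induction hc with
      | refl => exact hx
      | tail _ h ih =>
        have := h.2
        rw [← hU, Finset.mem_union] at this
        rcases this with h' | h'
        · exact h'
        · exact absurd h.1 (he _ ih _ h')
    have hx := hx0
    rw [← hU, Finset.mem_union] at hx
    rcases hx with hx | hx
    · obtain ⟨b, hb⟩ := hB
      refine ⟨b, Finset.mem_sdiff.2 ⟨by rw [← hU]; simp [hb], fun h => ?_⟩⟩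
      exact Finset.disjoint_left.1 hd (key A B hU he hx b (Finset.mem_filter.1 h).2) hb
    · obtain ⟨b, hb⟩ := hA
      refine ⟨b, Finset.mem_sdiff.2 ⟨by rw [← hU]; simp [hb], fun h => ?_⟩⟩
      exact Finset.disjoint_left.1 hd hb (key B A (by rw [Finset.union_comm, hU]) (fun a ha b hb h => he b hb a ha h.symm) hx b (Finset.mem_filter.1 h).2)
  by_cases hC : ∀ w ∈ C, ¬ G.Adj v w
  · refine ⟨C, insert v (W \ C), Or.inl ⟨⟨x0, hx0C⟩, by simp, ?_, ?_, ?_⟩⟩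
    · rw [Finset.disjoint_insert_right]
      exact ⟨fun h => hv (hCW h), Finset.disjoint_sdiff⟩
    · rw [Finset.union_insert, Finset.union_sdiff_of_subset hCW]
    · intro a ha b hb hab
      rcases Finset.mem_insert.1 hb with rfl | hb
      · exact hC a ha hab.symm
      · have := Finset.mem_sdiff.1 hb
        exact this.2 (hCcl a ha b this.1 hab)
  by_cases hE : ∀ w ∈ W \ C, ¬ G.Adj v w
  · refine ⟨W \ C, insert v C, Or.inl ⟨hD, by simp, ?_, ?_, ?_⟩⟩
    · rw [Finset.disjoint_insert_right]
      exact ⟨fun h => hv (Finset.mem_sdiff.1 h).1, Finset.sdiff_disjoint⟩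
    · rw [Finset.union_insert, Finset.sdiff_union_of_subset hCW]
    · intro b hb a ha hab
      rcases Finset.mem_insert.1 ha with rfl | ha
      · exact hE b hb hab.symm
      · have := Finset.mem_sdiff.1 hb
        exact this.2 (hCcl a ha b this.1 hab.symm)
  exfalso
  push Not at hC hE
  obtain ⟨y0, hy0, hy0v⟩ := hC
  obtain ⟨z, hz, hzv⟩ := hE
  have hz' := Finset.mem_sdiff.1 hz
  have hnz : ∀ c ∈ C, ¬ G.Adj c z := fun c hc h => hz'.2 (hCcl c hc z hz'.1 h)
  have : ∀ c, Relation.ReflTransGen R x0 c → c ∈ C ∧ ¬ G.Adj v c := by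
    intro c hc
    induction hc with
    | refl => exact ⟨hx0C, hx0v⟩
    | tail _ h ih =>
      have hm := hCcl _ ih.1 _ h.2 h.1
      refine ⟨hm, fun hvc => ?_⟩
      exact hG _ _ v z h.1 hvc.symm hzv (fun h => ih.2 h.symm) (hnz _ ih.1) (hnz _ hm)
  exact (this y0 (Finset.mem_filter.1 hy0).2).2 hy0v

lemma split_exists {V : Type*} [DecidableEq V] (G : SimpleGraph V) (hG : P4Free G)
    (U : Finset V) : 2 ≤ U.card → ∃ A B, SepP G U A B ∨ JoiP G U A B := by
  induction U using Finset.induction_on with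
  | empty => simp
  | insert v W hv ih =>
    intro hc
    rw [Finset.card_insert_of_notMem hv] at hc
    by_cases h1 : W.card = 1
    · obtain ⟨w, rfl⟩ := Finset.card_eq_one.1 h1
      refine ⟨{v}, {w}, ?_⟩
      by_cases h : G.Adj v w
      · right; exact ⟨by simp, by simp, by simpa using hv, rfl, by simpa using h⟩
      · left; exact ⟨by simp, by simp, by simpa using hv, rfl, by simpa using h⟩
    · obtain ⟨A, B, h | h⟩ := ih (by omega)
      · exact split_step G hG W v hv A B h
      · obtain ⟨A', B', h⟩ := split_step Gᶜ (p4free_compl G hG) W v hv A B ((sep_compl _ _ _ _).2 h |> fun h => h)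
        rw [sep_compl, joi_compl] at h
        exact ⟨A', B', h.symm⟩

/-- induced connectivity -/
def Cn {V : Type*} (G : SimpleGraph V) (S : Finset V) : Prop := (G.induce (S : Set V)).Connected

lemma cn_nonempty {V : Type*} (G : SimpleGraph V) (S : Finset V) (h : Cn G S) : S.Nonempty := by
  obtain ⟨x⟩ := h.nonempty
  exact ⟨x.1, x.2⟩

lemma cn_single {V : Type*} (G : SimpleGraph V) (x : V) : Cn G {x} := by
  unfold Cn
  have : Subsingleton (({x} : Finset V) : Set V) := by
    rw [Finset.coe_singleton]; infer_instance
  have : Nonempty (({x} : Finset V) : Set V) := ⟨⟨x, by simp⟩⟩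
  exact ⟨fun a b => by rw [Subsingleton.elim a b]⟩

lemma cn_sep {V : Type*} [DecidableEq V] (G : SimpleGraph V) (U A B S : Finset V)
    (h : SepP G U A B) (hS : S ⊆ U) (hc : Cn G S) : S ⊆ A ∨ S ⊆ B := by
  obtain ⟨hA, hB, hd, hU, he⟩ := h
  by_contra hcon
  push Not at hcon
  obtain ⟨h1, h2⟩ := hcon
  obtain ⟨b, hb, hbA⟩ := Finset.not_subset.1 h1
  obtain ⟨a, ha, haB⟩ := Finset.not_subset.1 h2
  have hm : ∀ s ∈ S, s ∈ A ∨ s ∈ B := fun s hs => by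
    have := hS hs; rwa [← hU, Finset.mem_union] at this
  have haA := (hm a ha).resolve_right haB
  have hr := hc.preconnected ⟨a, ha⟩ ⟨b, hb⟩
  rw [SimpleGraph.reachable_iff_reflTransGen] at hr
  have : ∀ c : (S : Set V), Relation.ReflTransGen (G.induce (S : Set V)).Adj ⟨a, ha⟩ c → c.1 ∈ A := by
    intro c hc
    induction hc with
    | refl => exact haA
    | @tail p q _ h ih =>
      rcases hm q.1 q.2 with h' | h'
      · exact h'
      · exact absurd h (he _ ih _ h')
  exact hbA (this _ hr)

lemma cn_joi {V : Type*} [DecidableEq V] (G : SimpleGraph V) (U A B S : Finset V)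
    (h : JoiP G U A B) (hS : S ⊆ U) (hc : ¬ Cn G S) : S ⊆ A ∨ S ⊆ B := by
  obtain ⟨hA, hB, hd, hU, he⟩ := h
  by_contra hcon
  push Not at hcon
  obtain ⟨h1, h2⟩ := hcon
  obtain ⟨b, hb, hbA⟩ := Finset.not_subset.1 h1
  obtain ⟨a, ha, haB⟩ := Finset.not_subset.1 h2
  have hm : ∀ s ∈ S, s ∈ A ∨ s ∈ B := fun s hs => by
    have := hS hs; rwa [← hU, Finset.mem_union] at this
  have haA := (hm a ha).resolve_right haB
  have hbB := (hm b hb).resolve_left hbA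
  apply hc
  unfold Cn
  have hab : (G.induce (S : Set V)).Reachable ⟨a, ha⟩ ⟨b, hb⟩ := by
    apply SimpleGraph.Adj.reachable
    exact he a haA b hbB
  have key : ∀ x : (S : Set V), (G.induce (S : Set V)).Reachable ⟨a, ha⟩ x := by
    intro x
    rcases hm x.1 x.2 with h | h
    · refine hab.trans (SimpleGraph.Adj.reachable ?_)
      exact (he _ h _ hbB).symm
    · refine SimpleGraph.Adj.reachable ?_
      exact he _ haA _ h
  haveI : Nonempty (S : Set V) := ⟨⟨a, ha⟩⟩
  exact ⟨fun x y => (key x).symm.trans (key y)⟩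

lemma sum_split {V : Type*} [DecidableEq V] (A B : Finset V) (hd : Disjoint A B)
    (h : Finset V → ℤ) (h0 : ∀ S ⊆ A ∪ B, ¬ S ⊆ A → ¬ S ⊆ B → h S = 0) :
    ∑ S ∈ (A ∪ B).powerset, h S = ∑ S ∈ A.powerset, h S + ∑ S ∈ B.powerset, h S - h ∅ := by
  have e1 : ∑ S ∈ (A ∪ B).powerset, h S = ∑ S ∈ A.powerset ∪ B.powerset, h S := by
    symm
    apply Finset.sum_subset
    · apply Finset.union_subset <;> apply Finset.powerset_mono.2
      · exact Finset.subset_union_left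
      · exact Finset.subset_union_right
    · intro S hS hn
      simp only [Finset.mem_union, Finset.mem_powerset, not_or] at hS hn
      exact h0 S hS hn.1 hn.2
  have e2 := Finset.sum_union_inter (s₁ := A.powerset) (s₂ := B.powerset) (f := h)
  have e3 : A.powerset ∩ B.powerset = {∅} := by
    ext S
    simp only [Finset.mem_inter, Finset.mem_powerset, Finset.mem_singleton]
    constructor
    · rintro ⟨h1, h2⟩
      exact Finset.eq_empty_of_forall_notMem fun x hx => Finset.disjoint_left.1 hd (h1 hx) (h2 hx)
    · rintro rfl; simp
  rw [e3, Finset.sum_singleton] at e2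
  rw [e1]; linarith

lemma sum_card_pow {V : Type*} [DecidableEq V] (U : Finset V) :
    ∑ S ∈ U.powerset, (2 * (S.card : ℤ)) = U.card * 2 ^ U.card := by
  induction U using Finset.induction_on with
  | empty => simp
  | insert v W hv ih =>
    rw [Finset.sum_powerset_insert hv, ih]
    have : ∑ t ∈ W.powerset, (2 * ((insert v t).card : ℤ)) = ∑ t ∈ W.powerset, (2 * (t.card : ℤ) + 2) := by
      refine Finset.sum_congr rfl fun t ht => ?_
      rw [Finset.card_insert_of_notMem (fun h => hv (Finset.mem_powerset.1 ht h))]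
      push_cast; ring
    rw [this, Finset.sum_add_distrib, ih, Finset.card_insert_of_notMem hv]
    simp
    ring

lemma sum_loc {V : Type*} [DecidableEq V] (U : Finset V) (v : V) (hv : v ∈ U) :
    2 * ∑ S ∈ U.powerset, (if v ∈ S then (2 * (S.card : ℤ)) else 0) = (U.card + 1) * 2 ^ U.card ∧
    2 * ∑ S ∈ U.powerset, (if v ∈ S then (1 : ℤ) else 0) = 2 ^ U.card := by
  obtain ⟨W, hW, rfl⟩ : ∃ W, v ∉ W ∧ insert v W = U := ⟨U.erase v, by simp, Finset.insert_erase hv⟩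
  have hn : ∀ t ∈ W.powerset, v ∉ t := fun t ht h => hW (Finset.mem_powerset.1 ht h)
  rw [Finset.sum_powerset_insert hW, Finset.sum_powerset_insert hW]
  have z1 : ∀ f : Finset V → ℤ, ∑ t ∈ W.powerset, (if v ∈ t then f t else 0) = 0 := fun f =>
    Finset.sum_eq_zero fun t ht => if_neg (hn t ht)
  have : ∑ t ∈ W.powerset, (if v ∈ insert v t then (2 * ((insert v t).card : ℤ)) else 0) = ∑ t ∈ W.powerset, (2 * (t.card : ℤ) + 2) := by
    refine Finset.sum_congr rfl fun t ht => ?_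
    rw [Finset.card_insert_of_notMem (hn t ht)]
    simp; ring
  rw [this, z1 (fun t => 2 * (t.card : ℤ)), z1 (fun _ => 1), Finset.sum_add_distrib, sum_card_pow, Finset.card_insert_of_notMem hW]
  constructor
  · simp; ring
  · simp; ring

open Classical in
noncomputable def sm {V : Type*} (p : Finset V → Prop) (U : Finset V) (f : Finset V → ℤ) : ℤ :=
  ∑ S ∈ U.powerset, if p S then f S else 0

lemma sm_sep {V : Type*} [DecidableEq V] (G : SimpleGraph V) (U A B : Finset V) (h : SepP G U A B)
    (q : Finset V → Prop) (f : Finset V → ℤ) :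
    sm (fun S => q S ∧ Cn G S) U f = sm (fun S => q S ∧ Cn G S) A f + sm (fun S => q S ∧ Cn G S) B f := by
  unfold sm
  have hU := h.2.2.2.1
  have h0 : ¬ Cn G ∅ := fun h => by simpa using cn_nonempty _ _ h
  rw [← hU, sum_split A B h.2.2.1]
  · simp [h0]
  · intro S hS h1 h2
    rw [if_neg]
    rintro ⟨_, hc⟩
    rcases cn_sep G U A B S h (hU ▸ hS) hc with h | h <;> tauto

open Classical in
lemma sm_joi {V : Type*} [DecidableEq V] (G : SimpleGraph V) (U A B : Finset V) (h : JoiP G U A B)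
    (q : Finset V → Prop) (f : Finset V → ℤ) :
    sm q U f - sm (fun S => q S ∧ Cn G S) U f =
     (sm q A f - sm (fun S => q S ∧ Cn G S) A f) + (sm q B f - sm (fun S => q S ∧ Cn G S) B f)
      - (if q ∅ then f ∅ else 0) := by
  unfold sm
  have hU := h.2.2.2.1
  have h0 : ¬ Cn G ∅ := fun h => by simpa using cn_nonempty _ _ h
  simp only [← Finset.sum_sub_distrib]
  rw [← hU, sum_split A B h.2.2.1]
  · simp [h0]
  · intro S hS h1 h2
    have : Cn G S := by
      by_contra hc
      rcases cn_joi G U A B S h (hU ▸ hS) hc with h | h <;> tauto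
    simp [this]

lemma sm_zero {V : Type*} (p : Finset V → Prop) (U : Finset V) (f : Finset V → ℤ)
    (h : ∀ S ⊆ U, ¬ p S) : sm p U f = 0 :=
  Finset.sum_eq_zero fun S hS => if_neg (h S (Finset.mem_powerset.1 hS))

lemma sm_le {V : Type*} (p q : Finset V → Prop) (U : Finset V) (h : ∀ S, p S → q S) :
    sm p U (fun _ => 1) ≤ sm q U (fun _ => 1) := by
  refine Finset.sum_le_sum fun S _ => ?_
  by_cases hp : p S
  · simp [hp, h S hp]
  · simp only [hp, if_false]; split_ifs <;> norm_num

lemma sm_nonneg {V : Type*} (p : Finset V → Prop) (U : Finset V) :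
    0 ≤ sm p U (fun _ => 1) := by
  refine Finset.sum_nonneg fun S _ => ?_
  split_ifs <;> norm_num

lemma one_add_le_pow (d : ℕ) : (1 : ℤ) + d ≤ 2 ^ d := by
  have := Nat.lt_two_pow_self (n := d)
  have : d + 1 ≤ 2 ^ d := this
  have h : ((d + 1 : ℕ) : ℤ) ≤ ((2 ^ d : ℕ) : ℤ) := by exact_mod_cast this
  push_cast at h; linarith

lemma upper {V : Type*} [DecidableEq V] (G : SimpleGraph V) (hG : P4Free G) (n : ℕ) :
    ∀ U : Finset V, U.card = n → U.Nonempty →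
    sm (fun S => True ∧ Cn G S) U (fun S => 2 * S.card) < (U.card + 2) * sm (fun S => True ∧ Cn G S) U (fun _ => 1) := by
  induction n using Nat.strong_induction_on with
  | _ n ih =>
  intro U hn hne
  by_cases h1 : U.card = 1
  · obtain ⟨w, rfl⟩ := Finset.card_eq_one.1 h1
    have h0 : ¬ Cn G ∅ := fun h => by simpa using cn_nonempty _ _ h
    have e : ({w} : Finset V).powerset = {∅, {w}} := by
      ext S; simp [Finset.subset_singleton_iff]
    unfold sm
    rw [e, Finset.sum_pair (by simp [eq_comm]), Finset.sum_pair (by simp [eq_comm])]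
    simp [h0, cn_single]
  have hpos := hne.card_pos
  obtain ⟨A, B, hs | hj⟩ := split_exists G hG U (by omega)
  · rw [sm_sep G U A B hs, sm_sep G U A B hs]
    obtain ⟨hA, hB, hd, hU, he⟩ := hs
    have hcard : U.card = A.card + B.card := by rw [← hU, Finset.card_union_of_disjoint hd]
    have pA := hA.card_pos
    have pB := hB.card_pos
    have iA := ih A.card (by omega) A rfl hA
    have iB := ih B.card (by omega) B rfl hB
    have nA := sm_nonneg (fun S => True ∧ Cn G S) A
    have nB := sm_nonneg (fun S => True ∧ Cn G S) B
    rw [hcard]; push_cast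
    nlinarith [mul_nonneg (Int.natCast_nonneg B.card) nA, mul_nonneg (Int.natCast_nonneg A.card) nB]
  · have j1 := sm_joi G U A B hj (fun _ => True) (fun S => 2 * S.card)
    have j2 := sm_joi G U A B hj (fun _ => True) (fun _ => 1)
    obtain ⟨hA, hB, hd, hU, he⟩ := hj
    have hcard : U.card = A.card + B.card := by rw [← hU, Finset.card_union_of_disjoint hd]
    have pA := hA.card_pos
    have pB := hB.card_pos
    have iA := ih A.card (by omega) A rfl hA
    have iB := ih B.card (by omega) B rfl hB
    have nA := sm_nonneg (fun S => True ∧ Cn G S) A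
    have nB := sm_nonneg (fun S => True ∧ Cn G S) B
    have e1 : ∀ U : Finset V, sm (fun _ => True) U (fun S => 2 * (S.card : ℤ)) = U.card * 2 ^ U.card := by
      intro U; rw [← sum_card_pow]; simp [sm]
    have e2 : ∀ U : Finset V, sm (fun _ => True) U (fun S => 1) = 2 ^ U.card := by
      intro U; simp [sm]
    rw [e1, e1, e1] at j1
    rw [e2, e2, e2] at j2
    simp only [if_true, Finset.card_empty] at j1 j2
    have qA := one_add_le_pow A.card
    have qB := one_add_le_pow B.card
    rw [hcard] at j1 j2 ⊢
    push_cast at *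
    rw [pow_add] at j1 j2
    generalize sm (fun S => True ∧ Cn G S) U (fun S => 2 * (S.card : ℤ)) = XU at *
    generalize sm (fun S => True ∧ Cn G S) A (fun S => 2 * (S.card : ℤ)) = XA at *
    generalize sm (fun S => True ∧ Cn G S) B (fun S => 2 * (S.card : ℤ)) = XB at *
    generalize sm (fun S => True ∧ Cn G S) U (fun S => 1) = NU at *
    generalize sm (fun S => True ∧ Cn G S) A (fun S => 1) = NA at *
    generalize sm (fun S => True ∧ Cn G S) B (fun S => 1) = NB at *
    have a0 := Int.natCast_nonneg A.card
    have b0 := Int.natCast_nonneg B.card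
    generalize (2 : ℤ) ^ A.card = α at *
    generalize (2 : ℤ) ^ B.card = β at *
    generalize (A.card : ℤ) = a at *
    generalize (B.card : ℤ) = b at *
    have k1 : 0 ≤ (α - 1 - a) * (β - 1) := mul_nonneg (by linarith) (by linarith)
    have k2 : 0 ≤ (β - 1 - b) * (α - 1) := mul_nonneg (by linarith) (by linarith)
    have k3 := mul_nonneg b0 nA
    have k4 := mul_nonneg a0 nB
    have hX : XU = (a + b) * (α * β) - a * α - b * β + XA + XB := by linarith
    have hN : NU = α * β - α - β + 1 + NA + NB := by linarith
    rw [hX, hN]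
    nlinarith

lemma lower_joi {V : Type*} [DecidableEq V] (G : SimpleGraph V)
    (v : V) (U A B : Finset V) (hj : JoiP G U A B) (hv : v ∈ A)
    (h : 0 ≤ 2 * sm (fun S => v ∈ S ∧ Cn G S) A (fun S => 2 * S.card) -
      2 * (A.card + 2) * sm (fun S => v ∈ S ∧ Cn G S) A (fun _ => 1) + 2 ^ A.card) :
    (U.card + 1) * sm (fun S => v ∈ S ∧ Cn G S) U (fun _ => 1) ≤
      sm (fun S => v ∈ S ∧ Cn G S) U (fun S => 2 * S.card) := by
  have j1 := sm_joi G U A B hj (fun S => v ∈ S) (fun S => 2 * S.card)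
  have j2 := sm_joi G U A B hj (fun S => v ∈ S) (fun _ => 1)
  obtain ⟨hA, hB, hd, hU, he⟩ := hj
  have hvB : v ∉ B := Finset.disjoint_left.1 hd hv
  have hvU : v ∈ U := by rw [← hU]; simp [hv]
  have hcard : U.card = A.card + B.card := by rw [← hU, Finset.card_union_of_disjoint hd]
  have pB := hB.card_pos
  rw [sm_zero _ B _ (fun S hS h => hvB (hS h)), sm_zero _ B _ (fun S hS h => hvB (hS h.1))] at j1 j2
  have e1 : ∀ U : Finset V, v ∈ U → 2 * sm (fun S => v ∈ S) U (fun S => 2 * (S.card : ℤ)) = (U.card + 1) * 2 ^ U.card := by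
    intro U hU; rw [← (sum_loc U v hU).1]; unfold sm; congr! 
  have e2 : ∀ U : Finset V, v ∈ U → 2 * sm (fun S => v ∈ S) U (fun S => 1) = 2 ^ U.card := by
    intro U hU; rw [← (sum_loc U v hU).2]; unfold sm; congr!
  have hle := sm_le (fun S => v ∈ S ∧ Cn G S) (fun S => v ∈ S) A (fun S h => h.1)
  have a1 := e1 U hvU
  have a2 := e2 U hvU
  have a3 := e1 A hv
  have a4 := e2 A hv
  simp only [Finset.notMem_empty, if_false] at j1 j2
  have b1 : (1 : ℤ) ≤ B.card := by exact_mod_cast pB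
  rw [hcard] at a1 a2 ⊢
  push_cast at *
  rw [pow_add] at a1 a2
  generalize sm (fun S => v ∈ S ∧ Cn G S) U (fun S => 2 * (S.card : ℤ)) = XU at *
  generalize sm (fun S => v ∈ S ∧ Cn G S) A (fun S => 2 * (S.card : ℤ)) = XA at *
  generalize sm (fun S => v ∈ S ∧ Cn G S) U (fun S => 1) = NU at *
  generalize sm (fun S => v ∈ S ∧ Cn G S) A (fun S => 1) = NA at *
  generalize sm (fun S => v ∈ S) U (fun S => 2 * (S.card : ℤ)) = YU at *
  generalize sm (fun S => v ∈ S) A (fun S => 2 * (S.card : ℤ)) = YA at *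
  generalize sm (fun S => v ∈ S) U (fun S => 1) = MU at *
  generalize sm (fun S => v ∈ S) A (fun S => 1) = MA at *
  generalize (2 : ℤ) ^ A.card = α at *
  generalize (2 : ℤ) ^ B.card = β at *
  generalize (A.card : ℤ) = a at *
  generalize (B.card : ℤ) = b at *
  have hX : 2 * XU = (a + b + 1) * (α * β) - (a + 1) * α + 2 * XA := by linarith
  have hN : 2 * NU = α * β - α + 2 * NA := by linarith
  have k : 0 ≤ (b - 1) * (α - 2 * NA) := mul_nonneg (by linarith) (by linarith)
  have : (a + b + 1) * (2 * NU) ≤ 2 * XU := by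
    rw [hX, hN]; nlinarith
  linarith

lemma lower {V : Type*} [DecidableEq V] (G : SimpleGraph V) (hG : P4Free G) (v : V) (n : ℕ) :
    ∀ U : Finset V, U.card = n → v ∈ U →
    0 ≤ 2 * sm (fun S => v ∈ S ∧ Cn G S) U (fun S => 2 * S.card) -
      2 * (U.card + 2) * sm (fun S => v ∈ S ∧ Cn G S) U (fun _ => 1) + 2 ^ U.card := by
  induction n using Nat.strong_induction_on with
  | _ n ih =>
  intro U hn hv
  by_cases h1 : U.card = 1
  · obtain ⟨w, rfl⟩ := Finset.card_eq_one.1 h1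
    have h0 : ¬ Cn G ∅ := fun h => by simpa using cn_nonempty _ _ h
    have e : ({w} : Finset V).powerset = {∅, {w}} := by
      ext S; simp [Finset.subset_singleton_iff]
    obtain rfl := Finset.mem_singleton.1 hv
    unfold sm
    rw [e, Finset.sum_pair (by simp [eq_comm]), Finset.sum_pair (by simp [eq_comm])]
    simp [h0, cn_single]
  have hpos := Finset.card_pos.2 ⟨v, hv⟩
  have hle := sm_le (fun S => v ∈ S ∧ Cn G S) (fun S => v ∈ S) U (fun S h => h.1)
  have e2 : ∀ U : Finset V, v ∈ U → 2 * sm (fun S => v ∈ S) U (fun S => 1) = 2 ^ U.card := by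
    intro U hU; rw [← (sum_loc U v hU).2]; unfold sm; congr!
  have e2U := e2 U hv
  have seps : ∀ A B, SepP G U A B → v ∈ A → 0 ≤ 2 * sm (fun S => v ∈ S ∧ Cn G S) U (fun S => 2 * S.card) -
      2 * (U.card + 2) * sm (fun S => v ∈ S ∧ Cn G S) U (fun _ => 1) + 2 ^ U.card := by
    intro A B hs hvA
    rw [sm_sep G U A B hs, sm_sep G U A B hs]
    obtain ⟨hA, hB, hd, hU, he⟩ := hs
    have hvB : v ∉ B := Finset.disjoint_left.1 hd hvA
    have hcard : U.card = A.card + B.card := by rw [← hU, Finset.card_union_of_disjoint hd]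
    have pB := hB.card_pos
    have iA := ih A.card (by omega) A rfl hvA
    rw [sm_zero _ B _ (fun S hS h => hvB (hS h.1)), sm_zero _ B _ (fun S hS h => hvB (hS h.1))]
    have hleA := sm_le (fun S => v ∈ S ∧ Cn G S) (fun S => v ∈ S) A (fun S h => h.1)
    have e2A := e2 A hvA
    have q := one_add_le_pow B.card
    have r := one_add_le_pow A.card
    rw [hcard, pow_add]
    push_cast
    have b0 := Int.natCast_nonneg B.card
    have a0 := Int.natCast_nonneg A.card
    have k1 : 0 ≤ (B.card : ℤ) * (2 ^ A.card - 2 * sm (fun S => v ∈ S ∧ Cn G S) A (fun _ => 1)) :=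
      mul_nonneg b0 (by linarith)
    have k2 : 0 ≤ (2 : ℤ) ^ A.card * (2 ^ B.card - 1 - B.card) := mul_nonneg (by linarith) (by linarith)
    nlinarith
  have jois : ∀ A B, JoiP G U A B → v ∈ A → 0 ≤ 2 * sm (fun S => v ∈ S ∧ Cn G S) U (fun S => 2 * S.card) -
      2 * (U.card + 2) * sm (fun S => v ∈ S ∧ Cn G S) U (fun _ => 1) + 2 ^ U.card := by
    intro A B hj hvA
    have hcard : U.card = A.card + B.card := by
      rw [← hj.2.2.2.1, Finset.card_union_of_disjoint hj.2.2.1]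
    have pB := hj.2.1.card_pos
    have := lower_joi G v U A B hj hvA (ih A.card (by omega) A rfl hvA)
    linarith
  obtain ⟨A, B, hs | hj⟩ := split_exists G hG U (by omega)
  · have hx := hv
    rw [← hs.2.2.2.1, Finset.mem_union] at hx
    rcases hx with hx | hx
    · exact seps A B hs hx
    · exact seps B A ⟨hs.2.1, hs.1, hs.2.2.1.symm, by rw [Finset.union_comm, hs.2.2.2.1], fun a ha b hb h => hs.2.2.2.2 b hb a ha h.symm⟩ hx
  · have hx := hv
    rw [← hj.2.2.2.1, Finset.mem_union] at hx
    rcases hx with hx | hx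
    · exact jois A B hj hx
    · exact jois B A ⟨hj.2.1, hj.1, hj.2.2.1.symm, by rw [Finset.union_comm, hj.2.2.2.1], fun a ha b hb => (hj.2.2.2.2 b hb a ha).symm⟩ hx

lemma cn_univ {V : Type*} [Fintype V] (G : SimpleGraph V) (h : G.Connected) : Cn G Finset.univ := by
  unfold Cn
  rw [Finset.coe_univ]
  exact (SimpleGraph.Iso.connected_iff (SimpleGraph.induceUnivIso G)).2 h

lemma lower_conn {V : Type*} [Fintype V] [DecidableEq V] (G : SimpleGraph V) (hG : P4Free G) (hc : G.Connected)
    (v : V) (h2 : 2 ≤ Fintype.card V) :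
    ((Finset.univ : Finset V).card + 1) * sm (fun S => v ∈ S ∧ Cn G S) Finset.univ (fun _ => 1) ≤
      sm (fun S => v ∈ S ∧ Cn G S) Finset.univ (fun S => 2 * S.card) := by
  obtain ⟨A, B, hs | hj⟩ := split_exists G hG Finset.univ (by simpa using h2)
  · exfalso
    obtain ⟨a, ha⟩ := hs.1
    obtain ⟨b, hb⟩ := hs.2.1
    rcases cn_sep G _ A B Finset.univ hs (subset_refl _) (cn_univ G hc) with h | h
    · exact Finset.disjoint_left.1 hs.2.2.1 (h (Finset.mem_univ b)) hb
    · exact Finset.disjoint_left.1 hs.2.2.1 ha (h (Finset.mem_univ a))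
  · have hx := Finset.mem_univ v
    rw [← hj.2.2.2.1, Finset.mem_union] at hx
    rcases hx with hx | hx
    · exact lower_joi G v _ A B hj hx (lower G hG v _ A rfl hx)
    · exact lower_joi G v _ B A ⟨hj.2.1, hj.1, hj.2.2.1.symm, by rw [Finset.union_comm, hj.2.2.2.1], fun a ha b hb => (hj.2.2.2.2 b hb a ha).symm⟩ hx (lower G hG v _ B rfl hx)

theorem stmt_4 {V : Type*} [Fintype V] (G : SimpleGraph V)
    (hcog : IsCograph G) (hconn : G.Connected) (v : V) :
    localMean G v ≥ globalMean G ∧ (localMean G v = globalMean G ↔ Fintype.card V = 1) := by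
  classical
  have hG := p4free_of_cograph G hcog
  have hcs : connSets G = Finset.univ.filter (fun S => Cn G S) := by
    ext S
    simp only [connSets, Set.Finite.mem_toFinset, Set.mem_setOf_eq, Finset.mem_filter, Finset.mem_univ, true_and]
    exact ⟨fun h => h.2, fun h => ⟨cn_nonempty G S h, h⟩⟩
  have hls : localSets G v = Finset.univ.filter (fun S => v ∈ S ∧ Cn G S) := by
    ext S
    simp only [localSets, Set.Finite.mem_toFinset, Set.mem_setOf_eq, Finset.mem_filter, Finset.mem_univ, true_and]
    exact Iff.rfl
  have hpos : 1 ≤ Fintype.card V := Fintype.card_pos_iff.2 ⟨v⟩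
  by_cases h1 : Fintype.card V = 1
  · have : Subsingleton V := Fintype.card_le_one_iff_subsingleton.1 h1.le
    have e : connSets G = localSets G v := by
      rw [hcs, hls]
      ext S
      simp only [Finset.mem_filter, Finset.mem_univ, true_and]
      refine ⟨fun h => ⟨?_, h⟩, fun h => h.2⟩
      obtain ⟨x, hx⟩ := cn_nonempty G S h
      rwa [Subsingleton.elim v x]
    have : localMean G v = globalMean G := by
      unfold localMean globalMean; rw [e]
    exact ⟨this.ge, fun _ => h1, fun _ => this⟩
  suffices h : globalMean G < localMean G v from
    ⟨h.le, fun h' => absurd h' h.ne', fun h' => absurd h' h1⟩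
  have h2 : 2 ≤ Fintype.card V := by omega
  have lo := lower_conn G hG hconn v h2
  have hec : (Finset.univ.erase v).card = Fintype.card V - 1 := by
    rw [Finset.card_erase_of_mem (Finset.mem_univ v), Finset.card_univ]
  have up := upper G hG _ (Finset.univ.erase v) rfl (Finset.card_pos.1 (by omega))
  set Q := Finset.univ.filter (fun S => v ∉ S ∧ Cn G S) with hQ
  have hunion : connSets G = localSets G v ∪ Q := by
    rw [hcs, hls, hQ]; ext S
    simp only [Finset.mem_filter, Finset.mem_univ, true_and, Finset.mem_union]
    tauto
  have hdis : Disjoint (localSets G v) Q := by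
    rw [hls, hQ, Finset.disjoint_left]
    intro S h h'
    exact (Finset.mem_filter.1 h').2.1 (Finset.mem_filter.1 h).2.1
  have sl : ∀ f : Finset V → ℤ, sm (fun S => v ∈ S ∧ Cn G S) Finset.univ f = ∑ S ∈ localSets G v, f S := by
    intro f
    unfold sm
    rw [hls, Finset.sum_filter, Finset.powerset_univ]
    refine Finset.sum_congr rfl fun S _ => ?_
    congr
  have sq : ∀ f : Finset V → ℤ, sm (fun S => True ∧ Cn G S) (Finset.univ.erase v) f = ∑ S ∈ Q, f S := by
    intro f
    unfold sm
    simp only [true_and]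
    rw [← Finset.sum_filter]
    refine Finset.sum_congr ?_ fun _ _ => rfl
    ext S
    simp [hQ, Finset.mem_powerset, Finset.subset_erase]
  rw [sl, sl] at lo
  rw [sq, sq, hec] at up
  rw [Nat.cast_sub hpos] at up
  simp only [← Finset.mul_sum, Finset.sum_const, nsmul_eq_mul, mul_one, Finset.card_univ] at lo up
  have hl0 : 0 < (localSets G v).card := by
    apply Finset.card_pos.2
    refine ⟨{v}, ?_⟩
    rw [hls]; simp [cn_single]
  unfold globalMean localMean
  rw [hunion, Finset.sum_union hdis, Finset.card_union_of_disjoint hdis]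
  have lo' : ((Fintype.card V : ℝ) + 1) * (localSets G v).card ≤ 2 * ∑ S ∈ localSets G v, (S.card : ℝ) := by
    exact_mod_cast lo
  have up' : 2 * ∑ S ∈ Q, (S.card : ℝ) < ((Fintype.card V : ℝ) - 1 + 2) * Q.card := by
    exact_mod_cast up
  have hl0' : (0 : ℝ) < (localSets G v).card := by exact_mod_cast hl0
  have hq0 : (0 : ℝ) ≤ Q.card := by positivity
  push_cast
  rw [div_lt_div_iff₀ (by linarith) hl0']
  nlinarith [mul_lt_mul_of_pos_right up' hl0', mul_le_mul_of_nonneg_right lo' hq0]
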